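/- If X is a core compact topological space, then the lattice O_X of open subsets of X, endowed with the Scott topology, is a core compact topological space. -/

import Mathlib

open TopologicalSpace

/-- A subset of a complete lattice is *Scott open* if it is an upper set and every
nonempty directed subset whose supremum belongs to it meets it. -/
def ScottOpen {L : Type*} [CompleteLattice L] (A : Set L) : Prop :=
  IsUpperSet A ∧
    ∀ D : Set L, D.Nonempty → DirectedOn (· ≤ ·) D → sSup D ∈ A → (D ∩ A).Nonempty

/-- The Scott topology on a complete lattice. -/
def scottTopology (L : Type*) [CompleteLattice L] : TopologicalSpace L where
  IsOpen := ScottOpen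
  isOpen_univ := ⟨isUpperSet_univ, fun D hD _ _ => by simpa using hD⟩
  isOpen_inter := fun A B hA hB => by
    refine ⟨hA.1.inter hB.1, fun D hD hdir hsup => ?_⟩
    obtain ⟨a, haD, haA⟩ := hA.2 D hD hdir hsup.1
    obtain ⟨b, hbD, hbB⟩ := hB.2 D hD hdir hsup.2
    obtain ⟨c, hcD, hac, hbc⟩ := hdir a haD b hbD
    exact ⟨c, hcD, hA.1 hac haA, hB.1 hbc hbB⟩
  isOpen_sUnion := fun S hS => by
    constructor
    · intro a b hab ha
      obtain ⟨t, htS, hat⟩ := ha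
      exact ⟨t, htS, (hS t htS).1 hab hat⟩
    · intro D hD hdir hsup
      obtain ⟨t, htS, hst⟩ := hsup
      obtain ⟨d, hdD, hdt⟩ := (hS t htS).2 D hD hdir hst
      exact ⟨d, hdD, t, htS, hdt⟩

/-- A topological space is *core compact* if for every point `x` and open set `U ∋ x`
there is an open `V ∋ x` such that every open cover of `U` has a finite subfamily
covering `V`. -/
def CoreCompact (Y : Type*) [TopologicalSpace Y] : Prop :=
  ∀ (x : Y) (U : Set Y), IsOpen U → x ∈ U →
    ∃ V : Set Y, IsOpen V ∧ x ∈ V ∧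
      ∀ 𝒰 : Set (Set Y), (∀ W ∈ 𝒰, IsOpen W) → U ⊆ ⋃₀ 𝒰 →
        ∃ F : Finset (Set Y), ↑F ⊆ 𝒰 ∧ V ⊆ ⋃₀ ↑F

/-- `a` is *way below* `b` if every nonempty directed set whose supremum lies above `b`
has a member above `a`. -/
def WayBelow {L : Type*} [CompleteLattice L] (a b : L) : Prop :=
  ∀ D : Set L, D.Nonempty → DirectedOn (· ≤ ·) D → b ≤ sSup D → ∃ d ∈ D, a ≤ d

namespace WayBelow

variable {L : Type*} [CompleteLattice L] {a b c : L}

theorem le (hab : WayBelow a b) : a ≤ b := by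
  obtain ⟨d, rfl, hd⟩ := hab {b} (Set.singleton_nonempty b) (directedOn_singleton b) (by simp)
  exact hd

theorem trans_le (hab : WayBelow a b) (hbc : b ≤ c) : WayBelow a c :=
  fun D hD hdir hc => hab D hD hdir (hbc.trans hc)

theorem bot (b : L) : WayBelow ⊥ b :=
  fun _ ⟨d, hd⟩ _ _ => ⟨d, hd, bot_le⟩

theorem sup (hac : WayBelow a c) (hbc : WayBelow b c) : WayBelow (a ⊔ b) c := by
  intro D hD hdir hc
  obtain ⟨d, hd, had⟩ := hac D hD hdir hc
  obtain ⟨e, he, hbe⟩ := hbc D hD hdir hc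
  obtain ⟨f, hf, hdf, hef⟩ := hdir d hd e he
  exact ⟨f, hf, sup_le (had.trans hdf) (hbe.trans hef)⟩

/-- In a continuous lattice the elements which `a` is way below form a Scott open set. -/
theorem scottOpen_setOf (hL : ∀ b : L, b ≤ sSup {c | WayBelow c b}) (a : L) :
    ScottOpen {b | WayBelow a b} := by
  refine ⟨fun b c hbc hab => hab.trans_le hbc, fun D ⟨d₀, hd₀⟩ hdir ha => ?_⟩
  obtain ⟨w, ⟨d, hd, hwd⟩, haw⟩ := ha {w | ∃ d ∈ D, WayBelow w d} ⟨⊥, d₀, hd₀, bot d₀⟩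
    (by
      rintro v ⟨d, hd, hvd⟩ w ⟨e, he, hwe⟩
      obtain ⟨f, hf, hdf, hef⟩ := hdir d hd e he
      exact ⟨v ⊔ w, ⟨f, hf, (hvd.trans_le hdf).sup (hwe.trans_le hef)⟩,
        le_sup_left, le_sup_right⟩)
    (sSup_le fun d hd => (hL d).trans (sSup_le_sSup fun w hw => ⟨d, hd, hw⟩))
  refine ⟨d, hd, fun E hE hEdir hdE => ?_⟩
  obtain ⟨e, he, hwe⟩ := hwd E hE hEdir hdE
  exact ⟨e, he, haw.trans hwe⟩

end WayBelow

/-- The Scott topology of a continuous lattice is core compact. -/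
theorem coreCompact_scottTopology_of_le_sSup_wayBelow {L : Type*} [CompleteLattice L]
    (hL : ∀ b : L, b ≤ sSup {c | WayBelow c b}) :
    @CoreCompact L (scottTopology L) := by
  intro x A hA hx
  obtain ⟨v, hvx, hvA⟩ := hA.2 {c | WayBelow c x} ⟨⊥, WayBelow.bot x⟩
    (fun a ha b hb => ⟨a ⊔ b, WayBelow.sup ha hb, le_sup_left, le_sup_right⟩)
    (hA.1 (hL x) hx)
  refine ⟨{b | WayBelow v b}, WayBelow.scottOpen_setOf hL v, hvx, fun 𝒰 h𝒰 hcover => ?_⟩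
  obtain ⟨W, hW, hvW⟩ := hcover hvA
  exact ⟨{W}, by simpa using hW, fun b hb => ⟨W, by simp, (h𝒰 W hW).1 hb.le hvW⟩⟩

/-- A finite union of members of a nonempty directed family of open sets is contained in a
member of the family. -/
theorem DirectedOn.exists_sUnion_subset {X : Type*} [TopologicalSpace X] {D : Set (Opens X)}
    (hdir : DirectedOn (· ≤ ·) D) (hD : D.Nonempty) (F : Finset (Set X))
    (hF : (F : Set (Set X)) ⊆ (↑) '' D) : ∃ W ∈ D, ⋃₀ (F : Set (Set X)) ⊆ W := by
  classical
  induction F using Finset.induction_on with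
  | empty => simpa [Set.Nonempty] using hD
  | insert A F _ ih =>
    rw [Finset.coe_insert, Set.insert_subset_iff] at hF
    obtain ⟨⟨V, hV, rfl⟩, hF⟩ := hF
    obtain ⟨W, hW, hFW⟩ := ih hF
    obtain ⟨Z, hZ, hVZ, hWZ⟩ := hdir V hV W hW
    refine ⟨Z, hZ, ?_⟩
    rw [Finset.coe_insert, Set.sUnion_insert]
    exact Set.union_subset hVZ (hFW.trans hWZ)

/-- The lattice of open sets of a core compact space is continuous. -/
theorem CoreCompact.le_sSup_wayBelow {X : Type*} [TopologicalSpace X] (h : CoreCompact X)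
    (U : Opens X) : U ≤ sSup {V | WayBelow V U} := by
  intro x hx
  obtain ⟨V, hV, hxV, hcompact⟩ := h x U U.isOpen hx
  refine Opens.mem_sSup.2 ⟨⟨V, hV⟩, fun D hD hdir hU => ?_, hxV⟩
  obtain ⟨F, hFD, hVF⟩ := hcompact ((↑) '' D)
    (by rintro _ ⟨W, -, rfl⟩; exact W.isOpen)
    (fun y hy => by
      obtain ⟨W, hW, hyW⟩ := Opens.mem_sSup.1 (hU hy)
      exact ⟨W, ⟨W, hW, rfl⟩, hyW⟩)
  obtain ⟨W, hW, hFW⟩ := hdir.exists_sUnion_subset hD F hFD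
  exact ⟨W, hW, hVF.trans hFW⟩

/-- If `X` is a core compact topological space, then the lattice of open subsets of `X`
endowed with the Scott topology is core compact. -/
theorem coreCompact_scottTopology_coreCompact {X : Type*} [TopologicalSpace X]
    (h : CoreCompact X) :
    @CoreCompact (Opens X) (scottTopology (Opens X)) :=
  coreCompact_scottTopology_of_le_sSup_wayBelow h.le_sSup_wayBelow
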